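/- arXiv:1308.5506 — 5 statements merged into one kernel-verified Lean document; each statement's English description precedes it below -/
import Mathlib

section
/- Let L be a finite relational first-order language. Let C and D be L-structures with underlying set ℕ such that for every relation symbol R of L, of arity n, the relation R^C is decidable (the function (Fin n → ℕ) → Bool deciding membership is computable) and likewise R^D. Suppose C and D are both ultrahomogeneous and Age(C) = Age(D). Then there exists a permutation g of ℕ such that both g and g⁻¹ are computable functions ℕ → ℕ and g is an isomorphism of L-structures from C to D. -/
open FirstOrder

namespace FirstOrder.Language

variable (L : Language) {M N : Type*} [L.Structure M] [L.Structure N]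

/-- A relation `s` between two structures is a partial isomorphism if it is the graph of an
injective partial function that preserves and reflects all relations. -/
def IsPartialIso (s : Set (M × N)) : Prop :=
  (∀ u ∈ s, ∀ v ∈ s, u.1 = v.1 ↔ u.2 = v.2) ∧
    ∀ (n : ℕ) (R : L.Relations n) (y : Fin n → M × N), (∀ i, y i ∈ s) →
      (Structure.RelMap R (Prod.fst ∘ y) ↔ Structure.RelMap R (Prod.snd ∘ y))

variable {L}

theorem IsPartialIso.swap {s : Set (M × N)} (h : L.IsPartialIso s) :
    L.IsPartialIso (Prod.swap ⁻¹' s) :=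
  ⟨fun _ hu _ hv => (h.1 _ hu _ hv).symm, fun n R y hy => (h.2 n R (Prod.swap ∘ y) hy).symm⟩

/-- A relation contained in the graph of an embedding of a substructure is a partial
isomorphism. -/
theorem isPartialIso_of_embedding {S : L.Substructure M} (f : S ↪[L] N) {s : Set (M × N)}
    (h : ∀ u ∈ s, ∃ hu : u.1 ∈ S, f ⟨u.1, hu⟩ = u.2) : L.IsPartialIso s := by
  refine ⟨fun u hu v hv => ?_, fun n R y hy => ?_⟩
  · obtain ⟨hu1, hu2⟩ := h u hu
    obtain ⟨hv1, hv2⟩ := h v hv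
    rw [← hu2, ← hv2, f.injective.eq_iff, Subtype.mk.injEq]
  · choose h1 h2 using fun i => h (y i) (hy i)
    have e1 : (Prod.snd ∘ y) = f ∘ fun i => ⟨(y i).1, h1 i⟩ := funext fun i => (h2 i).symm
    rw [e1, f.map_rel]
    exact (S.subtype.map_rel R fun i => ⟨(y i).1, h1 i⟩)

/-- A partial isomorphism restricts to an embedding of the substructure on its domain. -/
theorem IsPartialIso.exists_embedding [L.IsRelational] {s : Set (M × N)} (h : L.IsPartialIso s)
    {S : L.Substructure M} (hS : (S : Set M) = Prod.fst '' s) :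
    ∃ f : S ↪[L] N, ∀ u ∈ s, ∀ hu : u.1 ∈ S, f ⟨u.1, hu⟩ = u.2 := by
  have hm : ∀ x : S, ∃ u ∈ s, u.1 = x := fun x => by
    have := x.2
    rwa [← SetLike.mem_coe, hS] at this
  choose e he1 he2 using hm
  refine ⟨⟨⟨fun x => (e x).2, fun x y hxy => ?_⟩, fun {n} F => isEmptyElim F,
    fun {n} R x => ?_⟩, fun u hu hu' => ?_⟩
  · apply Subtype.ext
    rw [← he2, ← he2]
    exact (h.1 _ (he1 x) _ (he1 y)).2 hxy
  · have := h.2 n R (fun i => e (x i)) fun i => he1 _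
    refine this.symm.trans ?_
    have e1 : (Prod.fst ∘ fun i => e (x i)) = S.subtype ∘ x := funext fun i => he2 _
    rw [e1, S.subtype.map_rel]
  · exact (h.1 _ (he1 ⟨u.1, hu'⟩) _ hu).1 (he2 _)

end FirstOrder.Language

universe w

namespace FirstOrder.Language

variable {L : Language} {M N : Type w} [L.Structure M] [L.Structure N]

theorem isPartialIso_empty_of_age_subset (h : L.age M ⊆ L.age N) :
    L.IsPartialIso (∅ : Set (M × N)) := by
  obtain ⟨-, ⟨f⟩⟩ := h (age.fg_substructure (Substructure.fg_bot (L := L) (M := M)))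
  exact isPartialIso_of_embedding f (by simp)

theorem IsPartialIso.exists_insert [L.IsRelational] (h : L.age M ⊆ L.age N) (hN : L.IsUltrahomogeneous N)
    {s : Set (M × N)} (hs : L.IsPartialIso s) (hfin : s.Finite) (a : M) :
    ∃ b, L.IsPartialIso (insert (a, b) s) := by
  let S := Substructure.closure L (Prod.fst '' s)
  let T := Substructure.closure L (insert a (Prod.fst '' s))
  have hST : S ≤ T := Substructure.closure_mono (Set.subset_insert _ _)
  have hSfg : S.FG := Substructure.fg_closure (hfin.image _)
  have hTfg : T.FG := Substructure.fg_closure ((hfin.image _).insert _)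
  obtain ⟨-, hT⟩ := h (age.fg_substructure hTfg)
  obtain ⟨f, hf⟩ := hs.exists_embedding (Substructure.closure_eq_of_isRelational L _ :
    (S : Set M) = _)
  obtain ⟨g, hg⟩ := hN.extend_embedding (T := T) (h := hT)
    ((Substructure.fg_iff_structure_fg S).1 hSfg) f (Substructure.inclusion hST)
  have haT : a ∈ T := Substructure.subset_closure (Set.mem_insert _ _)
  refine ⟨g ⟨a, haT⟩, isPartialIso_of_embedding g fun u hu => ?_⟩
  obtain rfl | hu := hu
  · exact ⟨haT, rfl⟩
  · have hu' : u.1 ∈ S := Substructure.subset_closure ⟨u, hu, rfl⟩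
    refine ⟨hST hu', ?_⟩
    rw [← hf u hu hu', hg]
    rfl

end FirstOrder.Language

namespace ComputablePred

variable {α β : Type*} [Primcodable α] [Primcodable β]

theorem comp {p : β → Prop} (hp : ComputablePred p) {f : α → β} (hf : Computable f) :
    ComputablePred fun a => p (f a) := by
  obtain ⟨_, hp⟩ := hp
  exact ⟨fun a => inferInstance, hp.comp hf⟩

protected theorem and {p q : α → Prop} (hp : ComputablePred p) (hq : ComputablePred q) :
    ComputablePred fun a => p a ∧ q a := by
  obtain ⟨_, hp⟩ := hp
  obtain ⟨_, hq⟩ := hq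
  exact ((Primrec.and.to_comp.comp hp hq).of_eq fun a => by simp).computablePred

protected theorem or {p q : α → Prop} (hp : ComputablePred p) (hq : ComputablePred q) :
    ComputablePred fun a => p a ∨ q a := by
  obtain ⟨_, hp⟩ := hp
  obtain ⟨_, hq⟩ := hq
  exact ((Primrec.or.to_comp.comp hp hq).of_eq fun a => by simp).computablePred

protected theorem iff {p q : α → Prop} (hp : ComputablePred p) (hq : ComputablePred q) :
    ComputablePred fun a => p a ↔ q a :=
  ((hp.not.or hq).and (hq.not.or hp)).of_eq fun a => by tauto

theorem forall_finite {ι : Type*} [Finite ι] {p : ι → α → Prop}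
    (hp : ∀ i, ComputablePred (p i)) : ComputablePred fun a => ∀ i, p i a := by
  cases nonempty_fintype ι
  suffices h : ∀ s : Finset ι, ComputablePred fun a => ∀ i ∈ s, p i a from
    (h Finset.univ).of_eq fun a => by simp
  intro s
  classical
  induction s using Finset.induction_on with
  | empty => exact ((Computable.const true).of_eq fun a => by simp).computablePred
  | insert i s _ ih => exact ((hp i).and ih).of_eq fun a => by simp

theorem forall_lt {p : α → ℕ → Prop} (hp : ComputablePred fun x : α × ℕ => p x.1 x.2)
    {h : α → ℕ} (hh : Computable h) : ComputablePred fun a => ∀ k < h a, p a k := by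
  classical
  have hc : Computable fun a => Nat.rec (motive := fun _ => Bool) true
      (fun k r => r && decide (p a k)) (h a) :=
    Computable.nat_rec (h := fun a (x : ℕ × Bool) => x.2 && decide (p a x.1)) hh
      (Computable.const true) <|
        Primrec.and.to_comp.comp (Computable.snd.comp Computable.snd) <|
          hp.decide.comp (Computable.fst.pair (Computable.fst.comp Computable.snd))
  refine (hc.of_eq fun a => ?_).computablePred
  induction h a with
  | zero => simp
  | succ n ih =>
    simp only [ih]
    rw [← Bool.decide_and, decide_eq_decide]
    exact (Nat.forall_lt_succ_right (p := p a)).symm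

theorem forall_vector_lt {n : ℕ} {p : α → List.Vector ℕ n → Prop}
    (hp : ComputablePred fun x : α × List.Vector ℕ n => p x.1 x.2)
    {h : α → ℕ} (hh : Computable h) :
    ComputablePred fun a => ∀ v : List.Vector ℕ n, (∀ i, v.get i < h a) → p a v := by
  induction n generalizing α with
  | zero =>
    refine (hp.comp (Computable.id.pair (Computable.const List.Vector.nil))).of_eq fun a => ?_
    refine ⟨fun h v _ => ?_, fun h => h _ (fun i => i.elim0)⟩
    rwa [List.Vector.eq_nil v]
  | succ n ih =>
    have h1 : ComputablePred fun x : (α × ℕ) × List.Vector ℕ n => p x.1.1 (x.1.2 ::ᵥ x.2) :=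
      hp.comp ((Computable.fst.comp Computable.fst).pair
        (Computable.vector_cons.comp (Computable.snd.comp Computable.fst) Computable.snd))
    refine (forall_lt (p := fun a k => ∀ v : List.Vector ℕ n, (∀ i, v.get i < h a) → p a (k ::ᵥ v))
      (ih (p := fun x v => p x.1 (x.2 ::ᵥ v)) h1 (hh.comp Computable.fst)) hh).of_eq fun a =>
    ⟨fun H v hv => ?_, fun H k hk v hv => H _ (Fin.cases ?_ ?_)⟩
    · rw [← List.Vector.cons_head_tail v]
      refine H _ (by simpa using hv 0) _ fun i => ?_
      simpa using hv i.succ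
    · simpa using hk
    · simpa using hv

theorem exists_find {P : α → ℕ → Prop} {Q : α → Prop}
    (hP : ComputablePred fun x : α × ℕ => P x.1 x.2) (hQ : ComputablePred Q)
    (h : ∀ a, Q a → ∃ n, P a n) :
    ∃ g : α → ℕ, Computable g ∧ ∀ a, Q a → P a (g a) := by
  classical
  have hex : ∀ a, ∃ n, ¬ Q a ∨ P a n := fun a => by
    by_cases hQa : Q a
    · exact (h a hQa).imp fun _ => Or.inr
    · exact ⟨0, Or.inl hQa⟩
  exact ⟨_, Computable.find ((hQ.comp Computable.fst).not.or hP) hex,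
    fun a ha => (Nat.find_spec (hex a)).resolve_left (not_not_intro ha)⟩

/-- Quantification over the tuples with entries in a list preserves computability. -/
theorem forall_tuple_mem {n : ℕ} [Inhabited α] {p : (Fin n → α) → Prop} (hp : ComputablePred p) :
    ComputablePred fun l : List α => ∀ y : Fin n → α, (∀ i, y i ∈ l) → p y := by
  have hc : Computable fun (x : List α × List.Vector ℕ n) (i : Fin n) =>
      x.1.getD (x.2.get i) default :=
    (Primrec.fin_curry.2 ((Primrec.list_getD default).comp (Primrec.fst.comp Primrec.fst)
      (Primrec.vector_get.comp (Primrec.snd.comp Primrec.fst) Primrec.snd)).to₂).to_comp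
  refine (forall_vector_lt
    (p := fun (l : List α) (v : List.Vector ℕ n) => p fun i => l.getD (v.get i) default)
    (hp.comp hc) Computable.list_length).of_eq fun l =>
    ⟨fun H y hy => ?_, fun H v hv => H _ fun i => ?_⟩
  · choose k hk hk' using fun i => List.getElem_of_mem (hy i)
    have := H (List.Vector.ofFn k) (by simpa using hk)
    convert this using 2 with i
    simp [hk, hk']
  · simp [hv]

end ComputablePred

namespace FirstOrder.Language

variable {L : Language} [Finite (Σ n, L.Relations n)]

theorem computablePred_isPartialIso (SC SD : L.Structure ℕ)
    (hC : ∀ (n : ℕ) (R : L.Relations n), ComputablePred fun x : Fin n → ℕ => SC.RelMap R x)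
    (hD : ∀ (n : ℕ) (R : L.Relations n), ComputablePred fun x : Fin n → ℕ => SD.RelMap R x) :
    ComputablePred fun l : List (ℕ × ℕ) => @IsPartialIso L ℕ ℕ SC SD {u | u ∈ l} := by
  have hcomp {n : ℕ} {f : ℕ × ℕ → ℕ} (hf : Primrec f) :
      Computable fun (y : Fin n → ℕ × ℕ) => f ∘ y :=
    (Primrec.fin_curry.2 (hf.comp (Primrec.fin_app.comp Primrec.fst Primrec.snd)).to₂).to_comp
  have heq : ComputablePred fun x : Fin 2 → ℕ => x 0 = x 1 :=
    (Primrec.eq.comp (Primrec.fin_app.comp .id (.const 0))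
      (Primrec.fin_app.comp .id (.const 1))).computablePred
  have h1 := ((heq.comp (hcomp Primrec.fst)).iff (heq.comp (hcomp Primrec.snd))).forall_tuple_mem
  have h2 := ComputablePred.forall_finite fun R : Σ n, L.Relations n =>
    (((hC R.1 R.2).comp (hcomp Primrec.fst)).iff
      ((hD R.1 R.2).comp (hcomp Primrec.snd))).forall_tuple_mem
  refine (h1.and h2).of_eq fun l => and_congr ⟨fun H u hu v hv => ?_, fun H y hy => ?_⟩
    ⟨fun H n R => H ⟨n, R⟩, fun H R => H R.1 R.2⟩
  · exact H ![u, v] (Fin.cases hu (Fin.cases hv finZeroElim))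
  · exact H _ (hy 0) _ (hy 1)

end FirstOrder.Language

/-- A computable back-and-forth argument: if the finite relations satisfying `I` form a decidable
family of partial injections with the back-and-forth property, then there is a computable
permutation of `ℕ` with computable inverse, each finite part of which extends to a relation
satisfying `I`. -/
theorem exists_computable_perm_of_back_and_forth {I : Set (ℕ × ℕ) → Prop}
    (hI : ComputablePred fun l : List (ℕ × ℕ) => I {u | u ∈ l})
    (hinj : ∀ s, I s → ∀ u ∈ s, ∀ v ∈ s, u.1 = v.1 ↔ u.2 = v.2) (hempty : I ∅)
    (hforth : ∀ s, I s → s.Finite → ∀ a, ∃ b, I (insert (a, b) s))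
    (hback : ∀ s, I s → s.Finite → ∀ b, ∃ a, I (insert (a, b) s)) :
    ∃ g : Equiv.Perm ℕ, Computable (g : ℕ → ℕ) ∧ Computable (g.symm : ℕ → ℕ) ∧
      ∀ t : Finset ℕ, ∃ s, I s ∧ ∀ a ∈ t, (a, g a) ∈ s := by
  have hcons (u : ℕ × ℕ) (l : List (ℕ × ℕ)) : {v | v ∈ u :: l} = insert u {v | v ∈ l} := by
    ext; simp
  have hfin (l : List (ℕ × ℕ)) : {v | v ∈ l}.Finite := l.finite_toSet
  have hQ : ComputablePred fun x : List (ℕ × ℕ) × ℕ => I {u | u ∈ x.1} := hI.comp Computable.fst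
  obtain ⟨F, hFc, hF⟩ := ComputablePred.exists_find
    (P := fun (x : List (ℕ × ℕ) × ℕ) b => I {u | u ∈ (x.2, b) :: x.1})
    (hI.comp (Computable.list_cons.comp
      ((Computable.snd.comp Computable.fst).pair Computable.snd)
      (Computable.fst.comp Computable.fst))) hQ
    fun x hx => by simpa only [hcons] using hforth _ hx (hfin _) x.2
  obtain ⟨B, hBc, hB⟩ := ComputablePred.exists_find
    (P := fun (x : List (ℕ × ℕ) × ℕ) a => I {u | u ∈ (a, x.2) :: x.1})
    (hI.comp (Computable.list_cons.comp
      (Computable.snd.pair (Computable.snd.comp Computable.fst))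
      (Computable.fst.comp Computable.fst))) hQ
    fun x hx => by simpa only [hcons] using hback _ hx (hfin _) x.2
  let forth (x : ℕ × List (ℕ × ℕ)) : List (ℕ × ℕ) := (x.1, F (x.2, x.1)) :: x.2
  have hforthc : Computable forth := Computable.list_cons.comp
    (Computable.fst.pair (hFc.comp (Computable.snd.pair Computable.fst))) Computable.snd
  let back (x : ℕ × List (ℕ × ℕ)) : ℕ := B (forth x, x.1)
  have hbackc : Computable back := hBc.comp (hforthc.pair Computable.fst)
  let step (x : ℕ × List (ℕ × ℕ)) : List (ℕ × ℕ) := (back x, x.1) :: forth x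
  have hstepc : Computable step := Computable.list_cons.comp (hbackc.pair Computable.fst) hforthc
  let p (n : ℕ) : List (ℕ × ℕ) := Nat.rec [] (fun k l => step (k, l)) n
  have hpc : Computable p := Computable.nat_rec (h := fun _ x => step x) Computable.id
    (Computable.const []) (hstepc.comp Computable.snd)
  have hp (n : ℕ) : I {u | u ∈ p n} := by
    induction n with
    | zero => simpa [p] using hempty
    | succ n ih => exact hB (_, n) (hF (_, n) ih)
  have hmono : Monotone fun n => {u | u ∈ p n} := by
    refine monotone_nat_of_le_succ fun n u hu => ?_
    exact List.mem_cons_of_mem _ (List.mem_cons_of_mem _ hu)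
  have hg (a : ℕ) {n : ℕ} (h : a < n) : (a, F (p a, a)) ∈ p n :=
    hmono (Nat.succ_le_of_lt h) (List.mem_cons_of_mem _ List.mem_cons_self)
  have hh (b : ℕ) {n : ℕ} (h : b < n) : (back (b, p b), b) ∈ p n :=
    hmono (Nat.succ_le_of_lt h) List.mem_cons_self
  have hpair : Computable fun n => (n, p n) := Computable.id.pair hpc
  refine ⟨⟨fun a => F (p a, a), fun b => back (b, p b), fun a => ?_, fun b => ?_⟩,
    hFc.comp (hpc.pair Computable.id), hbackc.comp hpair, fun t =>
      ⟨_, hp (t.sup id + 1), fun a ha => hg a (Nat.lt_succ_of_le (Finset.le_sup (f := id) ha))⟩⟩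
  · exact (hinj _ (hp (max a (F (p a, a)) + 1)) _
      (hh (F (p a, a)) (Nat.lt_succ_of_le (le_max_right _ _))) _
      (hg a (Nat.lt_succ_of_le (le_max_left _ _)))).2 rfl
  · exact (hinj _ (hp (max b (back (b, p b)) + 1)) _
      (hg (back (b, p b)) (Nat.lt_succ_of_le (le_max_right _ _))) _
      (hh b (Nat.lt_succ_of_le (le_max_left _ _)))).1 rfl

/-- If `C` and `D` are ultrahomogeneous structures on `ℕ` for a finite
relational language, with decidable (computable) relations and the same age, then there is a
permutation of `ℕ`, computable with computable inverse, which is an isomorphism from `C` to `D`. -/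
theorem stmt_0 (L : FirstOrder.Language) [L.IsRelational]
    [Finite (Σ n, L.Relations n)]
    (SC SD : L.Structure ℕ)
    (hRC : ∀ (n : ℕ) (R : L.Relations n), ∃ f : (Fin n → ℕ) → Bool,
      Computable f ∧ ∀ x : Fin n → ℕ, f x = true ↔ SC.RelMap R x)
    (hRD : ∀ (n : ℕ) (R : L.Relations n), ∃ f : (Fin n → ℕ) → Bool,
      Computable f ∧ ∀ x : Fin n → ℕ, f x = true ↔ SD.RelMap R x)
    (hCu : @FirstOrder.Language.IsUltrahomogeneous L ℕ SC)
    (hDu : @FirstOrder.Language.IsUltrahomogeneous L ℕ SD)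
    (hage : @FirstOrder.Language.age L ℕ SC = @FirstOrder.Language.age L ℕ SD) :
    ∃ g : Equiv.Perm ℕ, Computable (g : ℕ → ℕ) ∧ Computable (g.symm : ℕ → ℕ) ∧
      ∀ (n : ℕ) (R : L.Relations n) (x : Fin n → ℕ),
        SC.RelMap R x ↔ SD.RelMap R (g ∘ x) := by
  have hC (n : ℕ) (R : L.Relations n) : ComputablePred fun x : Fin n → ℕ => SC.RelMap R x := by
    obtain ⟨f, hf, hfR⟩ := hRC n R
    exact ComputablePred.computable_iff.2 ⟨f, hf, funext fun x => propext (hfR x).symm⟩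
  have hD (n : ℕ) (R : L.Relations n) : ComputablePred fun x : Fin n → ℕ => SD.RelMap R x := by
    obtain ⟨f, hf, hfR⟩ := hRD n R
    exact ComputablePred.computable_iff.2 ⟨f, hf, funext fun x => propext (hfR x).symm⟩
  obtain ⟨g, hg, hg', hgI⟩ := exists_computable_perm_of_back_and_forth
    (FirstOrder.Language.computablePred_isPartialIso SC SD hC hD) (fun _ hs => hs.1)
    (@FirstOrder.Language.isPartialIso_empty_of_age_subset L ℕ ℕ SC SD hage.subset)
    (fun s hs hfin a => @FirstOrder.Language.IsPartialIso.exists_insert L ℕ ℕ SC SD _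
      hage.subset hDu s hs hfin a)
    fun s hs hfin b => by
      obtain ⟨a, ha⟩ := @FirstOrder.Language.IsPartialIso.exists_insert L ℕ ℕ SD SC _
        hage.symm.subset hCu _ (@FirstOrder.Language.IsPartialIso.swap L ℕ ℕ SC SD s hs)
        (hfin.preimage Prod.swap_injective.injOn) b
      refine ⟨a, ?_⟩
      convert @FirstOrder.Language.IsPartialIso.swap L ℕ ℕ SD SC _ ha using 1
      ext u
      simp [Prod.ext_iff, and_comm]
  refine ⟨g, hg, hg', fun n R x => ?_⟩
  obtain ⟨s, hs, hxs⟩ := hgI (Finset.univ.image x)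
  exact hs.2 n R (fun i => (x i, g (x i))) fun i => hxs _ (by simp)
end

section
/- There exists a Borel probability measure μ on the space M of codes of strict total orders on ℕ that is S∞-invariant: μ(σ • A) = μ(A) for every σ ∈ S∞ and every Borel set A ⊆ M, where S∞ acts on M by (σ • ξ)(x, y) = ξ(σ⁻¹ x, σ⁻¹ y). -/
/-- `ξ : ℕ × ℕ → Bool` codes a strict total (linear) order on `ℕ`. -/
def IsTotalOrderCode (ξ : ℕ × ℕ → Bool) : Prop :=
  (∀ x : ℕ, ξ (x, x) = false) ∧
  (∀ x y : ℕ, x ≠ y → Xor' (ξ (x, y) = true) (ξ (y, x) = true)) ∧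
  (∀ x y z : ℕ, ξ (x, y) = true → ξ (y, z) = true → ξ (x, z) = true)

/-- The space `M` of codes of strict total orders on `ℕ`, with the subspace topology from the
product topology on `ℕ × ℕ → Bool` (`Bool` discrete). -/
def M : Set (ℕ × ℕ → Bool) := {ξ | IsTotalOrderCode ξ}

/-- The logical action of `S∞ = Equiv.Perm ℕ` on `ℕ × ℕ → Bool`:
`(σ • ξ)(x, y) = ξ(σ⁻¹ x, σ⁻¹ y)`. -/
def permSMul (σ : Equiv.Perm ℕ) (ξ : ℕ × ℕ → Bool) : ℕ × ℕ → Bool :=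
  fun p => ξ (σ.symm p.1, σ.symm p.2)

theorem permSMul_mem (σ : Equiv.Perm ℕ) {ξ : ℕ × ℕ → Bool} (hξ : ξ ∈ M) :
    permSMul σ ξ ∈ M := by
  obtain ⟨h1, h2, h3⟩ := hξ
  exact ⟨fun x => h1 _,
    fun x y hxy => h2 _ _ (fun h => hxy (σ.symm.injective h)),
    fun x y z hxy hyz => h3 _ _ _ hxy hyz⟩

/-- The action of `S∞` on the space `M` of total order codes. -/
def permSMulM (σ : Equiv.Perm ℕ) (ξ : ↥M) : ↥M :=
  ⟨permSMul σ ξ.1, permSMul_mem σ ξ.2⟩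

open MeasureTheory ProbabilityTheory

theorem permSMulM_symm_permSMulM (σ : Equiv.Perm ℕ) (ξ : ↥M) :
    permSMulM σ.symm (permSMulM σ ξ) = ξ := by
  apply Subtype.ext
  funext p
  simp [permSMulM, permSMul]

theorem image_permSMulM_eq_preimage (σ : Equiv.Perm ℕ) (A : Set ↥M) :
    permSMulM σ '' A = permSMulM σ.symm ⁻¹' A :=
  congrFun (Set.image_eq_preimage_of_inverse (permSMulM_symm_permSMulM σ)
    (permSMulM_symm_permSMulM σ.symm)) A

/-- The strict total order on `ℕ` that compares `x` and `y` by the values `ω x` and `ω y`, and by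
`x` and `y` themselves when these values agree. -/
noncomputable def orderCodeOfSeq (ω : ℕ → ℝ) : ↥M :=
  ⟨fun p => decide (ω p.1 < ω p.2 ∨ (ω p.1 = ω p.2 ∧ p.1 < p.2)), by
    refine ⟨fun x => by simp, fun x y hxy => ?_, fun x y z hxy hyz => ?_⟩
    · simp only [decide_eq_true_eq]
      rcases lt_trichotomy (ω x) (ω y) with h | h | h
      · exact Or.inl ⟨Or.inl h, by grind⟩
      · rcases lt_or_gt_of_ne hxy with h' | h'
        · exact Or.inl ⟨Or.inr ⟨h, h'⟩, by grind⟩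
        · exact Or.inr ⟨Or.inr ⟨h.symm, h'⟩, by grind⟩
      · exact Or.inr ⟨Or.inl h, by grind⟩
    · simp only [decide_eq_true_eq] at *
      grind⟩

theorem measurable_orderCodeOfSeq : Measurable orderCodeOfSeq := by
  refine Measurable.subtype_mk (measurable_pi_lambda _ fun p => measurable_to_bool ?_)
  have hlt : MeasurableSet {ω : ℕ → ℝ | ω p.1 < ω p.2} :=
    measurableSet_lt (measurable_pi_apply _) (measurable_pi_apply _)
  have heq : MeasurableSet {ω : ℕ → ℝ | ω p.1 = ω p.2} :=
    measurableSet_eq_fun (measurable_pi_apply _) (measurable_pi_apply _)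
  convert! hlt.union (heq.inter (MeasurableSet.const (p.1 < p.2))) using 1
  ext ω
  simp

theorem permSMulM_symm_orderCodeOfSeq (σ : Equiv.Perm ℕ) {ω : ℕ → ℝ}
    (hω : Function.Injective ω) :
    permSMulM σ.symm (orderCodeOfSeq ω) = orderCodeOfSeq fun n => ω (σ n) := by
  apply Subtype.ext
  funext ⟨x, y⟩
  simp only [permSMulM, permSMul, orderCodeOfSeq, Equiv.symm_symm, decide_eq_decide]
  refine or_congr_right (and_congr_right fun h => ?_)
  obtain rfl : x = y := σ.injective (hω h)
  simp

theorem ae_injective_infinitePi (ν : Measure ℝ) [IsProbabilityMeasure ν] [NullSingletonClass ν] :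
    ∀ᵐ ω ∂(Measure.infinitePi fun _ : ℕ => ν), Function.Injective ω := by
  have hpair : ∀ i j : ℕ, i ≠ j →
      ∀ᵐ ω ∂(Measure.infinitePi fun _ : ℕ => ν), ω i ≠ ω j := by
    intro i j hij
    have hind : IndepFun (fun ω : ℕ → ℝ => ω i) (fun ω => ω j)
        (Measure.infinitePi fun _ : ℕ => ν) :=
      (iIndepFun_infinitePi (P := fun _ : ℕ => ν) (X := fun _ x => x)
        (fun _ => measurable_id)).indepFun hij
    rw [indepFun_iff_map_prod_eq_prod_map_map (measurable_pi_apply i).aemeasurable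
        (measurable_pi_apply j).aemeasurable,
      Measure.infinitePi_map_eval, Measure.infinitePi_map_eval] at hind
    have hdiag : ∀ᵐ p ∂(ν.prod ν), p.1 ≠ p.2 := by
      refine (Measure.ae_prod_iff_ae_ae
        (measurableSet_eq_fun measurable_fst measurable_snd).compl).2 ?_
      refine Filter.Eventually.of_forall fun x => ?_
      simp [ae_iff]
    rw [← hind] at hdiag
    exact ae_of_ae_map (f := fun ω : ℕ → ℝ => (ω i, ω j))
      ((measurable_pi_apply i).prodMk (measurable_pi_apply j)).aemeasurable hdiag
  have hall : ∀ᵐ ω ∂(Measure.infinitePi fun _ : ℕ => ν), ∀ i j : ℕ, i ≠ j → ω i ≠ ω j := by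
    simp only [ae_all_iff]
    exact hpair
  filter_upwards [hall] with ω hω i j hij
  by_contra hne
  exact hω i j hne hij

theorem measurePreserving_comp_perm_infinitePi (ν : Measure ℝ) [IsProbabilityMeasure ν]
    (σ : Equiv.Perm ℕ) :
    MeasurePreserving (fun (ω : ℕ → ℝ) n => ω (σ n))
      (Measure.infinitePi fun _ : ℕ => ν) (Measure.infinitePi fun _ : ℕ => ν) := by
  refine ⟨by fun_prop, ?_⟩
  convert! Measure.infinitePi_map_piCongrLeft (fun _ : ℕ => ν) σ.symm using 2
  funext ω n
  simpa using (MeasurableEquiv.piCongrLeft_apply_apply (β := fun _ : ℕ => ℝ) σ.symm ω (σ n)).symm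

theorem measurable_permSMulM (σ : Equiv.Perm ℕ) : Measurable (permSMulM σ) := by
  refine Measurable.subtype_mk (measurable_pi_lambda _ fun p => ?_)
  exact (measurable_pi_apply _).comp measurable_subtype_coe

theorem map_orderCodeOfSeq_image_permSMulM (ν : Measure ℝ) [IsProbabilityMeasure ν] [NullSingletonClass ν]
    (σ : Equiv.Perm ℕ) {A : Set ↥M} (hA : MeasurableSet A) :
    (Measure.infinitePi fun _ : ℕ => ν).map orderCodeOfSeq (permSMulM σ '' A) =
      (Measure.infinitePi fun _ : ℕ => ν).map orderCodeOfSeq A := by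
  have hT := measurePreserving_comp_perm_infinitePi ν σ
  rw [image_permSMulM_eq_preimage,
    Measure.map_apply measurable_orderCodeOfSeq (measurable_permSMulM _ hA),
    Measure.map_apply measurable_orderCodeOfSeq hA,
    ← hT.measure_preimage (measurable_orderCodeOfSeq hA).nullMeasurableSet]
  refine measure_congr ?_
  filter_upwards [ae_injective_infinitePi ν] with ω hω
  exact congrArg (· ∈ A) (permSMulM_symm_orderCodeOfSeq σ hω)

/-- There exists an `S∞`-invariant Borel probability measure on the space `M`
of codes of strict total orders on `ℕ`. -/
theorem stmt_7 :
    ∃ μ : @MeasureTheory.Measure (↥M) (borel ↥M),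
      μ Set.univ = 1 ∧
      ∀ (σ : Equiv.Perm ℕ) (A : Set ↥M), @MeasurableSet (↥M) (borel ↥M) A →
        μ (permSMulM σ '' A) = μ A := by
  rw [← BorelSpace.measurable_eq (α := ↥M)]
  have : NullSingletonClass (gaussianReal 0 1) := nullSingletonClass_gaussianReal one_ne_zero
  have := Measure.isProbabilityMeasure_map (μ := Measure.infinitePi fun _ : ℕ => gaussianReal 0 1)
    measurable_orderCodeOfSeq.aemeasurable
  exact ⟨_, measure_univ, fun σ _ hA =>
    map_orderCodeOfSeq_image_permSMulM (gaussianReal 0 1) σ hA⟩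
end

section
/- (Glasner–Weiss uniqueness) If μ₁ and μ₂ are Borel probability measures on the space M of codes of strict total orders on ℕ, each S∞-invariant (μᵢ(σ • A) = μᵢ(A) for every σ ∈ S∞ and Borel A ⊆ M, where (σ • ξ)(x, y) = ξ(σ⁻¹ x, σ⁻¹ y)), then μ₁ = μ₂. -/
open MeasureTheory

/-- The codes in `M` whose restriction to `{0, …, n - 1}` is the pullback along `ρ` of the usual
order. -/
def orderCylinder (n : ℕ) (ρ : Equiv.Perm (Fin n)) : Set ↥M :=
  {ξ | ∀ i j : Fin n, ξ.1 ((i : ℕ), (j : ℕ)) = true ↔ ρ i < ρ j}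

theorem exists_mem_orderCylinder (n : ℕ) (ξ : ↥M) : ∃ ρ, ξ ∈ orderCylinder n ρ := by
  obtain ⟨ξ, hirr, htot, htrans⟩ := ξ
  let below : Fin n → Finset (Fin n) := fun i => Finset.univ.filter fun j => ξ (j, i) = true
  have hlt (i : Fin n) : (below i).card < n := by
    have : below i ⊂ Finset.univ :=
      Finset.ssubset_univ_iff.2 fun h => by
        have hi : i ∈ below i := by rw [h]; exact Finset.mem_univ i
        simp [below, hirr] at hi
    simpa using Finset.card_lt_card this
  have hmono (i j : Fin n) (hij : ξ (i, j) = true) : (below i).card < (below j).card := by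
    refine Finset.card_lt_card ((Finset.ssubset_iff_of_subset fun k hk => ?_).2 ⟨i, ?_, ?_⟩)
    · simp only [below, Finset.mem_filter, Finset.mem_univ, true_and] at hk ⊢
      exact htrans _ _ _ hk hij
    · simpa [below] using hij
    · simp [below, hirr]
  have htri (i j : Fin n) (hij : i ≠ j) : ξ (i, j) = true ∨ ξ (j, i) = true :=
    Xor.or (htot i j fun h => hij (Fin.ext h))
  let f : Fin n → Fin n := fun i => ⟨(below i).card, hlt i⟩
  have hf : Function.Injective f := by
    intro i j hij
    by_contra hne
    have heq : (below i).card = (below j).card := congrArg Fin.val hij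
    rcases htri i j hne with h | h
    · exact (hmono _ _ h).ne heq
    · exact (hmono _ _ h).ne' heq
  refine ⟨Equiv.ofBijective f (Finite.injective_iff_bijective.1 hf), fun i j => ⟨hmono i j, ?_⟩⟩
  intro h
  have h' : (below i).card < (below j).card := h
  rcases eq_or_ne i j with rfl | hne
  · exact absurd h' (lt_irrefl _)
  · exact (htri i j hne).resolve_right fun hji => h'.not_gt (hmono _ _ hji)

theorem orderCylinder_perm_unique {n : ℕ} {ρ τ : Equiv.Perm (Fin n)} {ξ : ↥M}
    (hρ : ξ ∈ orderCylinder n ρ) (hτ : ξ ∈ orderCylinder n τ) : ρ = τ := by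
  let e : Fin n ≃o Fin n :=
    { toEquiv := ρ.symm.trans τ
      map_rel_iff' := by
        intro a b
        have h := (hτ (ρ.symm b) (ρ.symm a)).symm.trans (hρ (ρ.symm b) (ρ.symm a))
        simp only [Equiv.apply_symm_apply] at h
        simpa using not_congr h }
  ext i
  have h : e (ρ i) = ρ i := by rw [Subsingleton.elim e (OrderIso.refl _)]; rfl
  simpa [e] using (congrArg Fin.val h).symm

theorem orderCylinder_subset {m n : ℕ} (hmn : m ≤ n) {ρ : Equiv.Perm (Fin m)}
    {τ : Equiv.Perm (Fin n)} (h : (orderCylinder m ρ ∩ orderCylinder n τ).Nonempty) :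
    orderCylinder n τ ⊆ orderCylinder m ρ := by
  obtain ⟨ξ, hρ, hτ⟩ := h
  intro ζ hζ i j
  rw [← hρ i j]
  exact (hζ (Fin.castLE hmn i) (Fin.castLE hmn j)).trans
    (hτ (Fin.castLE hmn i) (Fin.castLE hmn j)).symm

theorem isPiSystem_orderCylinder :
    IsPiSystem {A : Set ↥M | ∃ n ρ, A = orderCylinder n ρ} := by
  rintro _ ⟨m, ρ, rfl⟩ _ ⟨n, τ, rfl⟩ h
  rcases le_total m n with hmn | hmn
  · exact ⟨n, τ, Set.inter_eq_right.2 (orderCylinder_subset hmn h)⟩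
  · exact ⟨m, ρ, Set.inter_eq_left.2 (orderCylinder_subset hmn (Set.inter_comm _ _ ▸ h))⟩

theorem measurableSet_orderCylinder (n : ℕ) (ρ : Equiv.Perm (Fin n)) :
    MeasurableSet (orderCylinder n ρ) := by
  simp only [orderCylinder, Set.ofPred_forall]
  refine MeasurableSet.iInter fun i => MeasurableSet.iInter fun j => ?_
  have hm : Measurable fun ξ : ↥M => ξ.1 ((i : ℕ), (j : ℕ)) :=
    (measurable_pi_apply _).comp measurable_subtype_coe
  exact hm (t := {b | b = true ↔ ρ i < ρ j}) .of_discrete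

theorem generateFrom_orderCylinder :
    (Subtype.instMeasurableSpace : MeasurableSpace ↥M) =
      MeasurableSpace.generateFrom {A : Set ↥M | ∃ n ρ, A = orderCylinder n ρ} := by
  apply le_antisymm
  · suffices h : @Measurable _ _ (MeasurableSpace.generateFrom
        {A : Set ↥M | ∃ n ρ, A = orderCylinder n ρ}) _ (Subtype.val : ↥M → ℕ × ℕ → Bool) from
      measurable_iff_comap_le.1 h
    let := MeasurableSpace.generateFrom {A : Set ↥M | ∃ n ρ, A = orderCylinder n ρ}
    refine measurable_pi_iff.2 fun p => measurable_to_bool ?_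
    let n := max p.1 p.2 + 1
    let i : Fin n := ⟨p.1, by omega⟩
    let j : Fin n := ⟨p.2, by omega⟩
    have h : (fun ξ : ↥M => ξ.1 p) ⁻¹' {true} =
        ⋃ ρ : {ρ : Equiv.Perm (Fin n) // ρ i < ρ j}, orderCylinder n ρ := by
      ext ξ
      simp only [Set.mem_preimage, Set.mem_singleton_iff, Set.mem_iUnion]
      constructor
      · intro hξ
        obtain ⟨ρ, hρ⟩ := exists_mem_orderCylinder n ξ
        exact ⟨⟨ρ, (hρ i j).1 hξ⟩, hρ⟩
      · rintro ⟨ρ, hρ⟩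
        exact (hρ i j).2 ρ.2
    rw [h]
    exact MeasurableSet.iUnion fun ρ => MeasurableSpace.measurableSet_generateFrom ⟨n, ρ, rfl⟩
  · refine MeasurableSpace.generateFrom_le ?_
    rintro _ ⟨n, ρ, rfl⟩
    exact measurableSet_orderCylinder n ρ

theorem exists_image_orderCylinder_one (n : ℕ) (ρ : Equiv.Perm (Fin n)) :
    ∃ σ, permSMulM σ '' orderCylinder n 1 = orderCylinder n ρ := by
  let e : Equiv.Perm ℕ := ρ.extendDomain Fin.equivSubtype
  have he (i : Fin n) : e i = ρ i := ρ.extendDomain_apply_image Fin.equivSubtype i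
  refine ⟨e.symm, Set.Subset.antisymm ?_ fun ξ hξ => ⟨permSMulM e ξ, ?_, ?_⟩⟩
  · rintro _ ⟨ξ, hξ, rfl⟩ i j
    simpa [permSMulM, permSMul, he] using hξ (ρ i) (ρ j)
  · intro i j
    have hs (k : Fin n) : e.symm k = ρ.symm k := by
      rw [Equiv.symm_apply_eq, he, Equiv.apply_symm_apply]
    simpa [permSMulM, permSMul, hs] using hξ (ρ.symm i) (ρ.symm j)
  · apply Subtype.ext
    funext p
    simp [permSMulM, permSMul]

theorem measure_orderCylinder (μ : Measure ↥M) (hp : μ Set.univ = 1)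
    (hi : ∀ (σ : Equiv.Perm ℕ) (A : Set ↥M), MeasurableSet A → μ (permSMulM σ '' A) = μ A)
    (n : ℕ) (ρ : Equiv.Perm (Fin n)) :
    μ (orderCylinder n ρ) = (n.factorial : ENNReal)⁻¹ := by
  have hone (τ : Equiv.Perm (Fin n)) : μ (orderCylinder n τ) = μ (orderCylinder n 1) := by
    obtain ⟨σ, hσ⟩ := exists_image_orderCylinder_one n τ
    rw [← hσ, hi σ _ (measurableSet_orderCylinder n 1)]
  have hcover : ⋃ τ, orderCylinder n τ = Set.univ :=
    Set.eq_univ_of_forall fun ξ => Set.mem_iUnion.2 (exists_mem_orderCylinder n ξ)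
  have hdisj : Pairwise (Function.onFun Disjoint (orderCylinder n)) := fun τ₁ τ₂ hne =>
    Set.disjoint_left.2 fun _ h₁ h₂ => hne (orderCylinder_perm_unique h₁ h₂)
  rw [← hcover, measure_iUnion hdisj (measurableSet_orderCylinder n), tsum_fintype] at hp
  simp only [hone, Finset.sum_const, Finset.card_univ, Fintype.card_perm, Fintype.card_fin,
    nsmul_eq_mul] at hp
  rw [hone]
  exact ENNReal.eq_inv_of_mul_eq_one_left ((mul_comm _ _).trans hp)

/-- **Glasner–Weiss uniqueness.** Any two `S∞`-invariant Borel probability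
measures on the space `M` of codes of strict total orders on `ℕ` coincide. -/
theorem stmt_8 (μ₁ μ₂ : @MeasureTheory.Measure (↥M) (borel ↥M))
    (hp₁ : μ₁ Set.univ = 1) (hp₂ : μ₂ Set.univ = 1)
    (hi₁ : ∀ (σ : Equiv.Perm ℕ) (A : Set ↥M), @MeasurableSet (↥M) (borel ↥M) A →
      μ₁ (permSMulM σ '' A) = μ₁ A)
    (hi₂ : ∀ (σ : Equiv.Perm ℕ) (A : Set ↥M), @MeasurableSet (↥M) (borel ↥M) A →
      μ₂ (permSMulM σ '' A) = μ₂ A) :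
    μ₁ = μ₂ := by
  have hborel : borel ↥M = Subtype.instMeasurableSpace := BorelSpace.measurable_eq.symm
  revert μ₁ μ₂
  rw [hborel]
  intro μ₁ μ₂ hp₁ hp₂ hi₁ hi₂
  have : IsFiniteMeasure μ₁ := ⟨by simp [hp₁]⟩
  refine ext_of_generate_finite _ generateFrom_orderCylinder isPiSystem_orderCylinder ?_
    (hp₁.trans hp₂.symm)
  rintro _ ⟨n, ρ, rfl⟩
  rw [measure_orderCylinder μ₁ hp₁ hi₁, measure_orderCylinder μ₂ hp₂ hi₂]
end

section
/- Let ≺₁ and ≺₂ be strict linear orders on ℕ that are decidable (the functions ℕ × ℕ → Bool deciding x ≺₁ y and x ≺₂ y are computable), and suppose each of (ℕ, ≺₁) and (ℕ, ≺₂) is a dense order with no least and no greatest element. Then there exists a permutation g of ℕ such that both g and g⁻¹ are computable and g is an order isomorphism: for all x, y ∈ ℕ, x ≺₁ y ↔ g x ≺₂ g y. -/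
/-- If `R` is a decidable relation admitting a witness at every state satisfying the invariant `P`,
then unbounded search produces a computable sequence of witnesses along the run of `next`. -/
theorem exists_computable_seq_of_search {σ τ : Type*} [Primcodable σ] [Denumerable τ]
    {R : σ → τ → Bool} (hR : Computable₂ R) {next : σ → τ → σ} (hnext : Computable₂ next)
    {P : σ → Prop} {s₀ : σ} (h₀ : P s₀) (hex : ∀ s, P s → ∃ t, R s t = true)
    (hP : ∀ s t, P s → R s t = true → P (next s t)) :
    ∃ (F : ℕ → σ) (q : ℕ → τ), Computable q ∧ F 0 = s₀ ∧
      ∀ n, R (F n) (q n) = true ∧ F (n + 1) = next (F n) (q n) := by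
  let search : σ →. τ := fun s => (Nat.rfind fun k => (R s (Denumerable.ofNat τ k) : Part Bool)).map
    (Denumerable.ofNat τ)
  have search_partrec : Partrec search := by
    refine Partrec.map (Partrec.rfind ?_) ((Computable.ofNat τ).comp Computable.snd).to₂
    exact (hR.comp Computable.fst ((Computable.ofNat τ).comp Computable.snd)).partrec.to₂
  have search_spec : ∀ s t, t ∈ search s → R s t = true := by
    intro s t ht
    obtain ⟨k, hk, rfl⟩ := (Part.mem_map_iff _).1 ht
    simpa using Nat.rfind_spec hk
  have search_total : ∀ s, P s → ∃ t, t ∈ search s := by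
    intro s hs
    obtain ⟨t, ht⟩ := hex s hs
    obtain ⟨k, hk, -⟩ := Nat.rfind_min' (p := fun k => R s (Denumerable.ofNat τ k))
      (m := Encodable.encode t) (by simpa using ht)
    exact ⟨_, Part.mem_map _ hk⟩
  let run : ℕ →. σ := fun n =>
    n.rec (Part.some s₀) fun _ IH => IH.bind fun s => (search s).map (next s)
  have run_partrec : Partrec run := by
    have hstep : Partrec₂ fun (_ : ℕ) (p : ℕ × σ) => (search p.2).map (next p.2) := by
      refine Partrec.map (search_partrec.comp (Computable.snd.comp Computable.snd)) ?_
      exact (hnext.comp (Computable.snd.comp (Computable.snd.comp Computable.fst))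
        Computable.snd).to₂
    exact Partrec.nat_rec Computable.id (Computable.const s₀).partrec hstep
  have run_total : ∀ n, ∃ s, s ∈ run n ∧ P s := by
    intro n
    induction n with
    | zero => exact ⟨s₀, Part.mem_some _, h₀⟩
    | succ n ih =>
      obtain ⟨s, hs, hPs⟩ := ih
      obtain ⟨t, ht⟩ := search_total s hPs
      exact ⟨next s t, Part.mem_bind hs (Part.mem_map _ ht), hP s t hPs (search_spec s t ht)⟩
  choose F hF hPF using run_total
  choose q hq using fun n => search_total (F n) (hPF n)
  have F_computable : Computable F := run_partrec.of_eq_tot hF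
  refine ⟨F, q, (search_partrec.comp F_computable).of_eq_tot hq, ?_, fun n => ⟨?_, ?_⟩⟩
  · exact Part.mem_some_iff.1 (hF 0)
  · exact search_spec _ _ (hq n)
  · exact Part.mem_unique (hF (n + 1)) (Part.mem_bind (hF n) (Part.mem_map _ (hq n)))

theorem Computable.list_all {α β : Type*} [Primcodable α] [Primcodable β] {l : α → List β}
    {p : α → β → Bool} (hl : Computable l) (hp : Computable₂ p) :
    Computable fun a => (l a).all (p a) := by
  have hrec : ∀ a n, ((l a).take n).all (p a) =
      Nat.rec (motive := fun _ => Bool) true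
        (fun i b => b && (((l a)[i]?).map (p a)).getD true) n := by
    intro a n
    induction n with
    | zero => simp
    | succ n ih =>
      simp only [List.take_add_one, List.all_append, ih]
      cases (l a)[n]? <;> simp
  have hstep : Computable₂ fun (a : α) (s : ℕ × Bool) =>
      s.2 && (((l a)[s.1]?).map (p a)).getD true := by
    refine Primrec.and.to_comp.comp (Computable.snd.comp Computable.snd)
      (Computable.option_getD (Computable.option_map ?_ ?_) (Computable.const true))
    · exact Computable.list_getElem?.comp (hl.comp Computable.fst)
        (Computable.fst.comp Computable.snd)
    · exact (hp.comp (Computable.fst.comp Computable.fst) Computable.snd).to₂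
  refine ((Computable.list_length.comp hl).nat_rec (Computable.const true) hstep).of_eq fun a => ?_
  rw [← hrec, List.take_length]

namespace IsTotalOrderCode

variable {f f₁ f₂ : ℕ × ℕ → Bool}

theorem isStrictTotalOrder (ho : IsTotalOrderCode f) :
    IsStrictTotalOrder ℕ fun x y => f (x, y) = true where
  trichotomous x y hxy hyx := by
    by_contra hne
    rcases ho.2.1 x y hne with h | h
    exacts [hxy h.1, hyx h.1]
  irrefl x h := by simp [ho.1 x] at h
  trans := ho.2.2

theorem eq_of_not_lt (ho : IsTotalOrderCode f) {x y : ℕ} (hxy : f (x, y) = false)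
    (hyx : f (y, x) = false) : x = y := by
  by_contra hne
  rcases ho.2.1 x y hne with h | h
  · simp [hxy] at h
  · simp [hyx] at h

theorem exists_between_finsets (ho : IsTotalOrderCode f)
    (hdense : ∀ x y : ℕ, f (x, y) = true → ∃ z, f (x, z) = true ∧ f (z, y) = true)
    (hnoleast : ∀ x : ℕ, ∃ y, f (y, x) = true) (hnogreatest : ∀ x : ℕ, ∃ y, f (x, y) = true)
    (A B : Finset ℕ) (hAB : ∀ a ∈ A, ∀ b ∈ B, f (a, b) = true) :
    ∃ m, (∀ a ∈ A, f (a, m) = true) ∧ ∀ b ∈ B, f (m, b) = true := by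
  have := ho.isStrictTotalOrder
  let order : LinearOrder ℕ := linearOrderOfSTO fun x y => f (x, y) = true
  exact @Order.exists_between_finsets ℕ order (@DenselyOrdered.mk ℕ order.toLT hdense)
    (@NoMinOrder.mk ℕ order.toLT hnoleast) (@NoMaxOrder.mk ℕ order.toLT hnogreatest) ⟨0⟩ A B hAB

end IsTotalOrderCode

/-- The pairs `p` and `r` satisfy the same relations in their first coordinates (for `f₁`) as in
their second coordinates (for `f₂`). -/
def orderCompatible (f₁ f₂ : ℕ × ℕ → Bool) (p r : ℕ × ℕ) : Bool :=
  (f₁ (p.1, r.1) == f₂ (p.2, r.2)) && (f₁ (r.1, p.1) == f₂ (r.2, p.2))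

theorem orderCompatible_iff {f₁ f₂ : ℕ × ℕ → Bool} {p r : ℕ × ℕ} :
    orderCompatible f₁ f₂ p r = true ↔
      f₁ (p.1, r.1) = f₂ (p.2, r.2) ∧ f₁ (r.1, p.1) = f₂ (r.2, p.2) := by
  simp [orderCompatible]

theorem orderCompatible_swap {f₁ f₂ : ℕ × ℕ → Bool} (p r : ℕ × ℕ) :
    orderCompatible f₂ f₁ p.swap r.swap = orderCompatible f₁ f₂ p r := by
  rw [Bool.eq_iff_iff, orderCompatible_iff, orderCompatible_iff]
  simp [eq_comm]

theorem computable₂_orderCompatible {f₁ f₂ : ℕ × ℕ → Bool} (hc₁ : Computable f₁)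
    (hc₂ : Computable f₂) : Computable₂ (orderCompatible f₁ f₂) := by
  have fst : Computable fun s : (ℕ × ℕ) × (ℕ × ℕ) => s.1 := Computable.fst
  have snd : Computable fun s : (ℕ × ℕ) × (ℕ × ℕ) => s.2 := Computable.snd
  have beq : Computable₂ fun a b : Bool => a == b := Primrec.beq.to_comp
  exact Primrec.and.to_comp.comp
    (beq.comp
      (hc₁.comp ((Computable.fst.comp fst).pair (Computable.fst.comp snd)))
      (hc₂.comp ((Computable.snd.comp fst).pair (Computable.snd.comp snd))))
    (beq.comp
      (hc₁.comp ((Computable.fst.comp snd).pair (Computable.fst.comp fst)))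
      (hc₂.comp ((Computable.snd.comp snd).pair (Computable.snd.comp fst))))

/-- A finite partial isomorphism into a dense order without endpoints extends to any new point. -/
theorem exists_orderCompatible {f₁ f₂ : ℕ × ℕ → Bool} (ho₁ : IsTotalOrderCode f₁)
    (ho₂ : IsTotalOrderCode f₂)
    (hdense : ∀ x y : ℕ, f₂ (x, y) = true → ∃ z, f₂ (x, z) = true ∧ f₂ (z, y) = true)
    (hnoleast : ∀ x : ℕ, ∃ y, f₂ (y, x) = true) (hnogreatest : ∀ x : ℕ, ∃ y, f₂ (x, y) = true)
    {L : List (ℕ × ℕ)} (hL : ∀ p ∈ L, ∀ r ∈ L, orderCompatible f₁ f₂ p r = true) (x : ℕ) :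
    ∃ y, ∀ r ∈ L, orderCompatible f₁ f₂ (x, y) r = true := by
  by_cases hx : ∃ y, (x, y) ∈ L
  · obtain ⟨y, hy⟩ := hx
    exact ⟨y, hL _ hy⟩
  obtain ⟨y, hyA, hyB⟩ := ho₂.exists_between_finsets hdense hnoleast hnogreatest
    ((L.filter fun r => f₁ (r.1, x)).map Prod.snd).toFinset
    ((L.filter fun r => f₁ (x, r.1)).map Prod.snd).toFinset (by
      intro a ha b hb
      simp only [List.mem_toFinset, List.mem_map, List.mem_filter] at ha hb
      obtain ⟨p, ⟨hp, hpx⟩, rfl⟩ := ha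
      obtain ⟨r, ⟨hr, hxr⟩, rfl⟩ := hb
      rw [← (orderCompatible_iff.1 (hL p hp r hr)).1]
      exact ho₁.2.2 _ _ _ hpx hxr)
  refine ⟨y, fun r hr => orderCompatible_iff.2 ?_⟩
  have hne : x ≠ r.1 := by
    rintro rfl
    exact hx ⟨r.2, hr⟩
  have lower : f₁ (r.1, x) = true → f₂ (r.2, y) = true := fun h => hyA _ <| by
    simp only [List.mem_toFinset, List.mem_map, List.mem_filter]
    exact ⟨r, ⟨hr, h⟩, rfl⟩
  have upper : f₁ (x, r.1) = true → f₂ (y, r.2) = true := fun h => hyB _ <| by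
    simp only [List.mem_toFinset, List.mem_map, List.mem_filter]
    exact ⟨r, ⟨hr, h⟩, rfl⟩
  have asymm : f₂ (y, r.2) = true → f₂ (r.2, y) = true → False := fun h h' => by
    simpa [ho₂.1] using ho₂.2.2 _ _ _ h h'
  rcases ho₁.2.1 x r.1 hne with ⟨h, h'⟩ | ⟨h, h'⟩ <;> grind

/-- Any two decidable (computable) strict linear orders on `ℕ` that are dense
with no least and no greatest element (i.e. rational Cantor orders) are isomorphic via a
permutation `g` of `ℕ` such that both `g` and `g⁻¹` are computable. -/
theorem stmt_10 (f₁ f₂ : ℕ × ℕ → Bool)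
    (hc₁ : Computable f₁) (hc₂ : Computable f₂)
    (ho₁ : IsTotalOrderCode f₁) (ho₂ : IsTotalOrderCode f₂)
    (hdense₁ : ∀ x y : ℕ, f₁ (x, y) = true → ∃ z, f₁ (x, z) = true ∧ f₁ (z, y) = true)
    (hnoleast₁ : ∀ x : ℕ, ∃ y, f₁ (y, x) = true)
    (hnogreatest₁ : ∀ x : ℕ, ∃ y, f₁ (x, y) = true)
    (hdense₂ : ∀ x y : ℕ, f₂ (x, y) = true → ∃ z, f₂ (x, z) = true ∧ f₂ (z, y) = true)
    (hnoleast₂ : ∀ x : ℕ, ∃ y, f₂ (y, x) = true)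
    (hnogreatest₂ : ∀ x : ℕ, ∃ y, f₂ (x, y) = true) :
    ∃ g : Equiv.Perm ℕ, Computable (g : ℕ → ℕ) ∧ Computable (g.symm : ℕ → ℕ) ∧
      ∀ x y : ℕ, f₁ (x, y) = true ↔ f₂ (g x, g y) = true := by
  let R : List (ℕ × ℕ) → ℕ × ℕ → Bool := fun L p => L.all (orderCompatible f₁ f₂ p) &&
    ((bif L.length.bodd then p.2 else p.1) == L.length.div2)
  have hR : Computable₂ R := by
    have len : Computable fun s : List (ℕ × ℕ) × (ℕ × ℕ) => s.1.length :=
      Computable.list_length.comp Computable.fst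
    refine Primrec.and.to_comp.comp (Computable.list_all Computable.fst
      ((computable₂_orderCompatible hc₁ hc₂).comp (Computable.snd.comp Computable.fst)
        Computable.snd).to₂) ?_
    exact Primrec.beq.to_comp.comp
      (Computable.cond (Computable.nat_bodd.comp len) (Computable.snd.comp Computable.snd)
        (Computable.fst.comp Computable.snd)) (Computable.nat_div2.comp len)
  have hR_iff : ∀ L p, R L p = true ↔ (∀ r ∈ L, orderCompatible f₁ f₂ p r = true) ∧
      (bif L.length.bodd then p.2 else p.1) = L.length.div2 := by
    simp [R]
  obtain ⟨F, q, hq, hF₀, hF⟩ := exists_computable_seq_of_search hR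
    (next := fun L p => p :: L) (Computable.list_cons.comp Computable.snd Computable.fst)
    (P := fun L => ∀ p ∈ L, ∀ r ∈ L, orderCompatible f₁ f₂ p r = true) (s₀ := []) (by simp)
    (fun L hL => by
      simp only [hR_iff]
      cases L.length.bodd with
      | false =>
        obtain ⟨y, hy⟩ := exists_orderCompatible ho₁ ho₂ hdense₂ hnoleast₂ hnogreatest₂ hL
          L.length.div2
        exact ⟨(_, y), hy, rfl⟩
      | true =>
        obtain ⟨x, hx⟩ := exists_orderCompatible ho₂ ho₁ hdense₁ hnoleast₁ hnogreatest₁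
          (L := L.map Prod.swap) (by
            simp only [List.mem_map]
            rintro _ ⟨p, hp, rfl⟩ _ ⟨r, hr, rfl⟩
            rw [orderCompatible_swap]
            exact hL p hp r hr) L.length.div2
        refine ⟨(x, _), fun r hr => ?_, rfl⟩
        rw [← orderCompatible_swap]
        exact hx _ (List.mem_map_of_mem hr))
    (fun L p hL hp => by
      have hpL := ((hR_iff L p).1 hp).1
      have hself : orderCompatible f₁ f₂ p p = true := by
        simp [orderCompatible_iff, ho₁.1, ho₂.1]
      simp only [orderCompatible_iff, List.mem_cons] at *
      grind)
  simp only [hR_iff] at hF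
  have hlen : ∀ n, (F n).length = n := by
    intro n
    induction n with
    | zero => simp [hF₀]
    | succ n ih => simp [(hF n).2, ih]
  have hmem : ∀ i n, i < n → q i ∈ F n := by
    intro i n hin
    induction n, hin using Nat.le_induction with
    | base => simp [(hF i).2]
    | succ n _ ih => simp [(hF n).2, ih]
  have hpres : ∀ i j, f₁ ((q i).1, (q j).1) = f₂ ((q i).2, (q j).2) := by
    intro i j
    rcases lt_trichotomy i j with h | rfl | h
    · exact (orderCompatible_iff.1 ((hF j).1.1 _ (hmem i j h))).2
    · rw [ho₁.1, ho₂.1]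
    · exact (orderCompatible_iff.1 ((hF i).1.1 _ (hmem j i h))).1
  have heven : ∀ x, (q (2 * x)).1 = x := fun x => by
    have := (hF (2 * x)).1.2
    simpa [hlen, Nat.div2_val] using this
  have hodd : ∀ y, (q (2 * y + 1)).2 = y := fun y => by
    have := (hF (2 * y + 1)).1.2
    simpa [hlen, Nat.div2_val, Nat.mul_add_div] using this
  have hdouble : Computable fun x : ℕ => 2 * x :=
    Primrec.nat_double.to_comp
  refine ⟨⟨fun x => (q (2 * x)).2, fun y => (q (2 * y + 1)).1, fun x => ?_, fun y => ?_⟩,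
    Computable.snd.comp (hq.comp hdouble),
    Computable.fst.comp (hq.comp (Computable.succ.comp hdouble)), fun x y => ?_⟩
  · refine ho₁.eq_of_not_lt ?_ ?_
    · nth_rw 2 [← heven x]
      rw [hpres, hodd, ho₂.1]
    · nth_rw 1 [← heven x]
      rw [hpres, hodd, ho₂.1]
  · refine ho₂.eq_of_not_lt ?_ ?_
    · nth_rw 2 [← hodd y]
      rw [← hpres, heven, ho₁.1]
    · nth_rw 1 [← hodd y]
      rw [← hpres, heven, ho₁.1]
  · have := hpres (2 * x) (2 * y)
    rw [heven, heven] at this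
    simp [this]
end

section
/- Let μ be any S∞-invariant Borel probability measure on the space M of codes of strict total orders on ℕ. Then the set Q ⊆ M of codes ξ whose order is dense and has no least and no greatest element (equivalently, whose order is order-isomorphic to the rational order ℚ) satisfies μ(Q) = 1. -/
open MeasureTheory

/-- In a finite measure space, the members of an infinite countable disjoint family of sets of
equal measure are null. -/
theorem measure_eq_zero_of_infinite_disjoint {α ι : Type*} [MeasurableSpace α] (μ : Measure α)
    [IsFiniteMeasure μ] [Infinite ι] [Countable ι] (E : ι → Set α)
    (hE : ∀ i, MeasurableSet (E i)) (hd : Pairwise (Function.onFun Disjoint E))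
    (hle : ∀ i j, μ (E i) ≤ μ (E j)) (i : ι) : μ (E i) = 0 := by
  by_contra h
  have hU := measure_iUnion (μ := μ) hd hE
  simp_rw [fun j => le_antisymm (hle j i) (hle i j)] at hU
  rw [ENNReal.tsum_const_eq_top_of_ne_zero h] at hU
  exact measure_ne_top μ _ hU

theorem permSMulM_permSMulM_symm (σ : Equiv.Perm ℕ) (ξ : ↥M) :
    permSMulM σ (permSMulM σ.symm ξ) = ξ := by
  apply Subtype.ext
  funext p
  simp [permSMulM, permSMul]

theorem isClosed_setOf_code_eq (p : ℕ × ℕ) (b : Bool) : IsClosed {ξ : ↥M | ξ.1 p = b} :=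
  isClosed_eq ((continuous_apply p).comp continuous_subtype_val) continuous_const

theorem isClosed_setOf_isGreatest (x : ℕ) : IsClosed {ξ : ↥M | ∀ y, ξ.1 (x, y) = false} := by
  simp_rw [Set.ofPred_forall]
  exact isClosed_iInter fun y => isClosed_setOf_code_eq _ _

theorem isClosed_setOf_isLeast (x : ℕ) : IsClosed {ξ : ↥M | ∀ y, ξ.1 (y, x) = false} := by
  simp_rw [Set.ofPred_forall]
  exact isClosed_iInter fun y => isClosed_setOf_code_eq _ _

theorem isClosed_setOf_covBy (x y : ℕ) :
    IsClosed {ξ : ↥M | ξ.1 (x, y) = true ∧ ∀ z, ξ.1 (x, z) = false ∨ ξ.1 (z, y) = false} := by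
  simp_rw [Set.ofPred_and, Set.ofPred_forall, Set.ofPred_or]
  exact (isClosed_setOf_code_eq _ _).inter <| isClosed_iInter fun z =>
    (isClosed_setOf_code_eq _ _).union (isClosed_setOf_code_eq _ _)

theorem code_total {ξ : ℕ × ℕ → Bool} (hξ : ξ ∈ M) {x y : ℕ} (hxy : x ≠ y) :
    ξ (x, y) = true ∨ ξ (y, x) = true :=
  Xor.or (hξ.2.1 x y hxy)

/-- For any `S∞`-invariant Borel probability measure `μ` on the space `M` of
codes of strict total orders on `ℕ`, the set `Q` of codes whose order is dense with no least and
no greatest element (equivalently, of order type of the rationals) has `μ Q = 1`. -/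
theorem stmt_13 (μ : @MeasureTheory.Measure (↥M) (borel ↥M))
    (hprob : μ Set.univ = 1)
    (hinv : ∀ (σ : Equiv.Perm ℕ) (A : Set ↥M), @MeasurableSet (↥M) (borel ↥M) A →
      μ (permSMulM σ '' A) = μ A) :
    μ {ξ : ↥M |
        (∀ x y : ℕ, ξ.1 (x, y) = true → ∃ z, ξ.1 (x, z) = true ∧ ξ.1 (z, y) = true) ∧
        (∀ x : ℕ, ∃ y, ξ.1 (y, x) = true) ∧
        (∀ x : ℕ, ∃ y, ξ.1 (x, y) = true)} = 1 := by
  let : MeasurableSpace ↥M := borel ↥M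
  have : BorelSpace ↥M := ⟨rfl⟩
  have : IsProbabilityMeasure μ := ⟨hprob⟩
  have hle : ∀ (σ : Equiv.Perm ℕ) (A B : Set ↥M), MeasurableSet A →
      (∀ ξ ∈ B, permSMulM σ.symm ξ ∈ A) → μ B ≤ μ A := by
    intro σ A B hA hBA
    rw [← hinv σ A hA]
    exact measure_mono fun ξ hξ => ⟨_, hBA ξ hξ, permSMulM_permSMulM_symm σ ξ⟩
  have hgreatest (x : ℕ) : μ {ξ : ↥M | ∀ y, ξ.1 (x, y) = false} = 0 := by
    refine measure_eq_zero_of_infinite_disjoint μ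
      (fun x : ℕ => {ξ : ↥M | ∀ y, ξ.1 (x, y) = false})
      (fun x => (isClosed_setOf_isGreatest x).measurableSet) ?_ ?_ x
    · intro a b hab
      refine Set.disjoint_left.2 fun ξ (ha : ∀ y, _) (hb : ∀ y, _) => ?_
      have := code_total ξ.2 hab
      simp [ha, hb] at this
    · intro a b
      refine hle (Equiv.swap a b) _ _ (isClosed_setOf_isGreatest b).measurableSet fun ξ h y => ?_
      simpa [permSMulM, permSMul] using h (Equiv.swap a b y)
  have hleast (x : ℕ) : μ {ξ : ↥M | ∀ y, ξ.1 (y, x) = false} = 0 := by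
    refine measure_eq_zero_of_infinite_disjoint μ
      (fun x : ℕ => {ξ : ↥M | ∀ y, ξ.1 (y, x) = false})
      (fun x => (isClosed_setOf_isLeast x).measurableSet) ?_ ?_ x
    · intro a b hab
      refine Set.disjoint_left.2 fun ξ (ha : ∀ y, _) (hb : ∀ y, _) => ?_
      have := code_total ξ.2 hab
      simp [ha, hb] at this
    · intro a b
      refine hle (Equiv.swap a b) _ _ (isClosed_setOf_isLeast b).measurableSet fun ξ h y => ?_
      simpa [permSMulM, permSMul] using h (Equiv.swap a b y)
  have hcovBy (x y : ℕ) : μ {ξ : ↥M | ξ.1 (x, y) = true ∧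
      ∀ z, ξ.1 (x, z) = false ∨ ξ.1 (z, y) = false} = 0 := by
    by_cases hyx : y = x
    · subst hyx
      convert measure_empty (μ := μ)
      ext ξ
      simp [ξ.2.1 y]
    have : Infinite {y : ℕ // y ≠ x} := (Set.finite_singleton x).infinite_compl.to_subtype
    refine measure_eq_zero_of_infinite_disjoint μ
      (fun y : {y : ℕ // y ≠ x} => {ξ : ↥M | ξ.1 (x, y.1) = true ∧
        ∀ z, ξ.1 (x, z) = false ∨ ξ.1 (z, y.1) = false})
      (fun y => (isClosed_setOf_covBy x y).measurableSet) ?_ ?_ ⟨y, hyx⟩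
    · intro a b hab
      refine Set.disjoint_left.2 fun ξ ⟨ha, ha'⟩ ⟨hb, hb'⟩ => ?_
      have := code_total ξ.2 (Subtype.coe_injective.ne hab)
      have h1 := ha' b
      have h2 := hb' a
      simp_all
    · intro a b
      refine hle (Equiv.swap a.1 b.1) _ _ (isClosed_setOf_covBy x b).measurableSet
        fun ξ h => ?_
      have hx : Equiv.swap a.1 b.1 x = x := Equiv.swap_apply_of_ne_of_ne a.2.symm b.2.symm
      refine ⟨?_, fun z => ?_⟩
      · simpa [permSMulM, permSMul, hx] using h.1
      · simpa [permSMulM, permSMul, hx] using h.2 (Equiv.swap a.1 b.1 z)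
  rw [← hprob]
  refine measure_congr (Filter.eventuallyEq_univ.2 ?_)
  have h1 : ∀ᵐ ξ ∂μ, ∀ x, ¬ ∀ y, ξ.1 (x, y) = false :=
    ae_all_iff.2 fun x => measure_eq_zero_iff_ae_notMem.1 (hgreatest x)
  have h2 : ∀ᵐ ξ ∂μ, ∀ x, ¬ ∀ y, ξ.1 (y, x) = false :=
    ae_all_iff.2 fun x => measure_eq_zero_iff_ae_notMem.1 (hleast x)
  have h3 : ∀ᵐ ξ ∂μ, ∀ x y, ¬ (ξ.1 (x, y) = true ∧
      ∀ z, ξ.1 (x, z) = false ∨ ξ.1 (z, y) = false) :=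
    ae_all_iff.2 fun x => ae_all_iff.2 fun y => measure_eq_zero_iff_ae_notMem.1 (hcovBy x y)
  filter_upwards [h1, h2, h3] with ξ h1 h2 h3
  refine ⟨fun x y hxy => ?_, fun x => ?_, fun x => ?_⟩
  · simpa [hxy] using h3 x y
  · simpa using h2 x
  · simpa using h1 x
end
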